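/- For all natural numbers j, k, l, the explicit expression P_{j,k,l} for the character χ₀ of the 3-strand family K⁻_{j,k,l} satisfies the HOMFLY–PT/Kauffman parity condition: with P⁺ := P_{j,k,l}(𝒾A, 𝒾q) and P⁻ := P_{j,k,l}(𝒾A, −𝒾q), one has P⁺ − P⁻ = ( (A − A⁻¹)/(q − q⁻¹) ) · ( P⁺ + P⁻ ); equivalently, the odd part ½(P⁺ − P⁻) equals (A − A⁻¹)/(q − q⁻¹) times the even part ½(P⁺ + P⁻). -/

import Mathlib

/- STATEMENT 19: For all natural numbers j, k, l, the explicit expression P_{j,k,l} for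
the character χ₀ of the 3-strand family K⁻_{j,k,l} satisfies the HOMFLY–PT/Kauffman
parity condition: with P⁺ := P_{j,k,l}(𝒾A, 𝒾q) and P⁻ := P_{j,k,l}(𝒾A, −𝒾q),
P⁺ − P⁻ = ((A − A⁻¹)/(q − q⁻¹))·(P⁺ + P⁻). -/

open Finset

/-- The explicit closed-form expression for the BMW character χ₀ of the 3-strand
family K⁻_{j,k,l}, as a function of the BMW parameters (α, β). -/
noncomputable def P {F : Type*} [Field F] (j k l : ℕ) (α β : F) : F :=
  α ^ (-(2 * ((k : ℤ) + (l : ℤ))) - 1) *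
      ∑ i ∈ Finset.range (2 * k + 2 * j + 2), β ^ (2 * ((k : ℤ) + (j : ℤ) - (i : ℤ)) + 1) +
    ∑ i ∈ Finset.range (2 * (k + j) + 2),
      α ^ (-(2 * ((k : ℤ) + (l : ℤ))) + (i : ℤ)) *
        (β ^ (2 * ((k : ℤ) + (j : ℤ) + 1) - (i : ℤ)) +
          β ^ (-(2 * ((k : ℤ) + (j : ℤ) + 1)) + (i : ℤ)) +
          2 * ∑ r ∈ Finset.range (2 * (k + j) + 1 - i),
              β ^ (2 * ((k : ℤ) + (j : ℤ) - (r : ℤ)) - (i : ℤ)))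

/-- The quantum integer `β ^ (s - 1) + β ^ (s - 3) + ⋯ + β ^ (1 - s)`. -/
def quantumInt {F : Type*} [Field F] (β : F) (s : ℕ) : F :=
  ∑ r ∈ range s, β ^ ((s : ℤ) - 1 - 2 * (r : ℤ))

section

variable {F : Type*} [Field F]

theorem mul_quantumInt_succ {β : F} (hβ : β ≠ 0) (s : ℕ) :
    β * quantumInt β (s + 1) = quantumInt β (s + 2) - β ^ (-((s : ℤ) + 1)) := by
  rw [eq_sub_iff_add_eq, quantumInt, quantumInt, sum_range_succ _ (s + 1), mul_sum]
  congr 1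
  · refine sum_congr rfl fun r _ => ?_
    rw [← zpow_one_add₀ hβ]
    congr 1
    push_cast
    ring
  · congr 1
    push_cast
    ring

theorem inv_mul_quantumInt_succ {β : F} (hβ : β ≠ 0) (s : ℕ) :
    β⁻¹ * quantumInt β (s + 1) = quantumInt β s + β ^ (-((s : ℤ) + 1)) := by
  rw [quantumInt, quantumInt, sum_range_succ, mul_add, mul_sum, ← zpow_neg_one]
  congr 1
  · refine sum_congr rfl fun r _ => ?_
    rw [← zpow_add₀ hβ]
    congr 1
    push_cast
    ring
  · rw [← zpow_add₀ hβ]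
    congr 1
    push_cast
    ring

theorem quantumInt_add_two_add {β : F} (hβ : β ≠ 0) (s : ℕ) :
    quantumInt β (s + 2) + quantumInt β s = (β + β⁻¹) * quantumInt β (s + 1) := by
  rw [add_mul, mul_quantumInt_succ hβ, inv_mul_quantumInt_succ hβ]
  ring

theorem quantumInt_add_two (β : F) (s : ℕ) :
    quantumInt β (s + 2) =
      quantumInt β s + β ^ ((s : ℤ) + 1) + β ^ (-((s : ℤ) + 1)) := by
  rw [quantumInt, quantumInt, sum_range_succ, sum_range_succ']
  congr 1
  · congr 1
    · refine sum_congr rfl fun r _ => ?_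
      congr 1
      push_cast
      ring
    · congr 1
      push_cast
      ring
  · congr 1
    push_cast
    ring

theorem quantumInt_neg_of_even (β : F) {s : ℕ} (hs : Even s) :
    quantumInt (-β) s = -quantumInt β s := by
  rw [quantumInt, quantumInt, ← sum_neg_distrib]
  refine sum_congr rfl fun r _ => Odd.neg_zpow ?_ β
  obtain ⟨t, rfl⟩ := hs
  exact ⟨t - 1 - r, by push_cast; ring⟩

theorem sum_range_two_mul (f : ℕ → F) (n : ℕ) :
    ∑ i ∈ range (2 * n), f i = ∑ t ∈ range n, (f (2 * t) + f (2 * t + 1)) := by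
  induction n with
  | zero => simp
  | succ n ih => rw [mul_add, mul_one, sum_range_succ, sum_range_succ, ih, sum_range_succ,
      add_assoc]

theorem inv_mul_add_sum_consecutive {α : F} (hα : α ≠ 0) (u : ℕ → F) (n : ℕ) :
    α⁻¹ * u 0 + ∑ t ∈ range n, α ^ (2 * t + 1) * (u t + u (t + 1)) =
      (α + α⁻¹) * ∑ t ∈ range n, α ^ (2 * t) * u t + α⁻¹ * α ^ (2 * n) * u n := by
  induction n with
  | zero => simp
  | succ n ih =>
    rw [sum_range_succ, sum_range_succ, ← add_assoc, ih]
    field_simp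
    ring

theorem P_eq_quantumInt {α : F} (hα : α ≠ 0) (β : F) (j k l : ℕ) :
    P j k l α β = α ^ (-(2 * ((k : ℤ) + (l : ℤ)))) *
      (α⁻¹ * quantumInt β (2 * (k + j + 1)) + ∑ i ∈ range (2 * (k + j + 1)),
        α ^ i * (quantumInt β (2 * (k + j + 1) - i + 1) +
          quantumInt β (2 * (k + j + 1) - i - 1))) := by
  rw [P, zpow_sub_one₀ hα, mul_add _ (α⁻¹ * _), ← mul_assoc _ α⁻¹, mul_sum (range (2 * (k + j + 1)))]
  congr 1
  · congr 1
    rw [quantumInt]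
    refine sum_congr (by congr 1; ring) fun r _ => ?_
    congr 1
    push_cast
    ring
  · refine sum_congr rfl fun i hi => ?_
    rw [mem_range] at hi
    obtain ⟨s, hs⟩ : ∃ s, 2 * (k + j + 1) = i + s + 1 := ⟨2 * (k + j + 1) - i - 1, by lia⟩
    have hs' : 2 * ((k : ℤ) + j + 1) = i + s + 1 := by exact_mod_cast hs
    rw [zpow_add₀ hα, zpow_natCast, mul_assoc, show 2 * (k + j + 1) - i + 1 = s + 2 by lia,
      show 2 * (k + j + 1) - i - 1 = s by lia, show 2 * (k + j) + 1 - i = s by lia,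
      quantumInt_add_two, hs', show (i : ℤ) + s + 1 - i = s + 1 by ring,
      show -((i : ℤ) + s + 1) + i = -(s + 1) by ring]
    have hsum : ∑ r ∈ range s, β ^ (2 * ((k : ℤ) + (j : ℤ) - (r : ℤ)) - (i : ℤ)) =
        quantumInt β s := by
      refine sum_congr rfl fun r _ => ?_
      congr 1
      linarith
    rw [hsum]
    ring

/-- Splitting `P` into the terms odd and even in `β`. -/
theorem P_eq_odd_add_even {α : F} (hα : α ≠ 0) (β : F) (j k l : ℕ) :
    P j k l α β = α ^ (-(2 * ((k : ℤ) + (l : ℤ)))) *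
      ((α⁻¹ * quantumInt β (2 * (k + j + 1)) + ∑ t ∈ range (k + j + 1),
        α ^ (2 * t + 1) * (quantumInt β (2 * (k + j + 1 - t)) +
          quantumInt β (2 * (k + j + 1 - (t + 1))))) +
      ∑ t ∈ range (k + j + 1), α ^ (2 * t) * (quantumInt β (2 * (k + j + 1 - t) + 1) +
          quantumInt β (2 * (k + j + 1 - t) - 1))) := by
  rw [P_eq_quantumInt hα, sum_range_two_mul, add_assoc (α⁻¹ * _), ← sum_add_distrib]
  congr 2
  refine sum_congr rfl fun t ht => ?_
  rw [mem_range] at ht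
  rw [add_comm, show 2 * (k + j + 1) - (2 * t + 1) + 1 = 2 * (k + j + 1 - t) by lia,
    show 2 * (k + j + 1) - (2 * t + 1) - 1 = 2 * (k + j + 1 - (t + 1)) by lia,
    show 2 * (k + j + 1) - 2 * t = 2 * (k + j + 1 - t) by lia]

theorem P_eq_quantumInt_even {α β : F} (hα : α ≠ 0) (hβ : β ≠ 0) (j k l : ℕ) :
    P j k l α β = α ^ (-(2 * ((k : ℤ) + (l : ℤ)))) * (((α + α⁻¹) + (β + β⁻¹)) *
      ∑ t ∈ range (k + j + 1), α ^ (2 * t) * quantumInt β (2 * (k + j + 1 - t))) := by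
  have hodd := inv_mul_add_sum_consecutive hα
    (fun t => quantumInt β (2 * (k + j + 1 - t))) (k + j + 1)
  have hzero : quantumInt β 0 = 0 := by simp [quantumInt]
  simp only [Nat.sub_zero, Nat.sub_self, mul_zero, hzero, add_zero] at hodd
  rw [P_eq_odd_add_even hα, hodd, add_mul (α + α⁻¹), mul_sum _ _ (β + β⁻¹)]
  congr 2
  refine sum_congr rfl fun t ht => ?_
  rw [mem_range] at ht
  obtain ⟨s, hs⟩ : ∃ s, 2 * (k + j + 1 - t) = s + 1 := ⟨2 * (k + j + 1 - t) - 1, by lia⟩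
  rw [hs, Nat.add_sub_cancel, quantumInt_add_two_add hβ]
  ring

end

theorem chi0_Kminus_parity {F : Type*} [Field F] (I A q : F)
    (hI : I ^ 2 = -1) (hA : A ≠ 0) (hq : q ≠ 0) (hqq : q - q⁻¹ ≠ 0) (j k l : ℕ) :
    P j k l (I * A) (I * q) - P j k l (I * A) (-(I * q)) =
      ((A - A⁻¹) / (q - q⁻¹)) *
        (P j k l (I * A) (I * q) + P j k l (I * A) (-(I * q))) := by
  have hI0 : I ≠ 0 := by
    rintro rfl
    simp at hI
  have hinv : I⁻¹ = -I := inv_eq_of_mul_eq_one_right (by linear_combination -hI)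
  have hα : I * A ≠ 0 := mul_ne_zero hI0 hA
  have hβ : I * q ≠ 0 := mul_ne_zero hI0 hq
  rw [P_eq_quantumInt_even hα hβ, P_eq_quantumInt_even hα (neg_ne_zero.mpr hβ)]
  simp only [quantumInt_neg_of_even _ (even_two_mul _), mul_neg, sum_neg_distrib, inv_neg]
  generalize ∑ t ∈ range (k + j + 1), (I * A) ^ (2 * t) *
    quantumInt (I * q) (2 * (k + j + 1 - t)) = S
  rw [mul_inv, mul_inv, hinv, div_mul_eq_mul_div, eq_div_iff hqq]
  ring
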